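/- Let B be a generalized Boolean algebra. The Stone space B̂ of B is compact if and only if B has a greatest element (i.e., B is a Boolean algebra). -/

import Mathlib

/-- A character of a generalized Boolean algebra `B`: a map `B → Bool` which is not
identically `false` and preserves `⊥`, joins, meets and relative complements. -/
def IsGBAChar {B : Type*} [GeneralizedBooleanAlgebra B] (l : B → Bool) : Prop :=
  (∃ a : B, l a = true) ∧ l ⊥ = false ∧
  (∀ a b : B, l (a ⊔ b) = (l a || l b)) ∧
  (∀ a b : B, l (a ⊓ b) = (l a && l b)) ∧
  (∀ a b : B, l (a \ b) = (l a && !l b))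

/-- The Stone space of a generalized Boolean algebra: the set of its characters. -/
def GBAChar (B : Type*) [GeneralizedBooleanAlgebra B] : Type _ :=
  {l : B → Bool // IsGBAChar l}

/-- The basic set `D(a)` in the Stone space. -/
def DS {B : Type*} [GeneralizedBooleanAlgebra B] (a : B) : Set (GBAChar B) :=
  {l | l.1 a = true}

/-- The topology of the Stone space is generated by the sets `D(a)`, `a ∈ B`. -/
instance {B : Type*} [GeneralizedBooleanAlgebra B] : TopologicalSpace (GBAChar B) :=
  TopologicalSpace.generateFrom {S | ∃ a : B, S = DS a}

/-- An element outside an ideal is separated from the ideal by a character. -/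
lemma exists_char_of_notMem_ideal {B : Type*} [GeneralizedBooleanAlgebra B]
    {I : Order.Ideal B} {b : B} (hb : b ∉ I) :
    ∃ l : GBAChar B, l.1 b = true ∧ ∀ a ∈ I, l.1 a = false := by
  classical
  have hd : Disjoint (Order.PFilter.principal b : Set B) (I : Set B) := by
    rw [Set.disjoint_left]
    intro x hx hxI
    exact hb (I.lower (Order.PFilter.mem_principal.1 hx) hxI)
  obtain ⟨J, hJ, hIJ, hdJ⟩ := DistribLattice.prime_ideal_of_disjoint_filter_ideal hd
  have hbJ : b ∉ J :=
    Set.disjoint_left.1 hdJ (Order.PFilter.mem_principal.2 le_rfl : b ∈ Order.PFilter.principal b)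
  have inf_mem (x y : B) : x ⊓ y ∈ J ↔ x ∈ J ∨ y ∈ J :=
    ⟨hJ.mem_or_mem, fun h => h.elim (J.lower inf_le_left) (J.lower inf_le_right)⟩
  have sdiff_mem (x y : B) : x \ y ∈ J ↔ x ∈ J ∨ y ∉ J := by
    constructor
    · intro h
      by_contra! hc
      exact hc.1 (J.lower le_sup_sdiff (Order.Ideal.sup_mem hc.2 h))
    · rintro (h | h)
      · exact J.lower sdiff_le h
      · refine ((inf_mem y (x \ y)).1 ?_).resolve_left h
        rw [inf_sdiff_self_right]
        exact J.bot_mem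
  refine ⟨⟨fun x => decide (x ∉ J), ⟨b, by simpa using hbJ⟩, by simp, ?_, ?_, ?_⟩,
    by simpa using hbJ, fun a ha => by simpa using hIJ ha⟩
  · intro x y
    simp only [Order.Ideal.sup_mem_iff]
    by_cases hx : x ∈ J <;> simp [hx]
  · intro x y
    by_cases hx : x ∈ J <;> simp [inf_mem, hx]
  · intro x y
    by_cases hx : x ∈ J <;> simp [sdiff_mem, hx]

lemma GBAChar.mono {B : Type*} [GeneralizedBooleanAlgebra B] (l : GBAChar B) {a b : B}
    (hab : a ≤ b) (ha : l.1 a = true) : l.1 b = true := by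
  have h := l.2.2.2.1 a b
  rwa [sup_eq_right.2 hab, ha, Bool.true_or] at h

lemma GBAChar.apply_finset_sup {B : Type*} [GeneralizedBooleanAlgebra B] (l : GBAChar B)
    (F : Finset B) : l.1 (F.sup id) = true ↔ ∃ a ∈ F, l.1 a = true := by
  classical
  induction F using Finset.induction_on with
  | empty => simp [l.2.2.1]
  | insert a F _ ih => simp [Finset.sup_insert, l.2.2.2.1, ih]

/-- The ideal generated by a set. -/
def idealClosure {B : Type*} [GeneralizedBooleanAlgebra B] (S : Set B) : Order.Ideal B where
  carrier := {x | ∃ F : Finset B, (F : Set B) ⊆ S ∧ x ≤ F.sup id}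
  lower' := fun _ _ hyx ⟨F, hF, hx⟩ => ⟨F, hF, hyx.trans hx⟩
  nonempty' := ⟨⊥, ∅, by simp, bot_le⟩
  directed' := by
    classical
    rintro x ⟨F, hF, hx⟩ y ⟨G, hG, hy⟩
    refine ⟨x ⊔ y, ⟨F ∪ G, by simp [hF, hG], ?_⟩, le_sup_left, le_sup_right⟩
    rw [Finset.sup_union]
    exact sup_le_sup hx hy

/-- If the sets `D(a)`, `a ∈ S`, cover the Stone space, then every element lies below a finite
join of elements of `S`. -/
lemma exists_finset_le_sup_of_cover {B : Type*} [GeneralizedBooleanAlgebra B] {S : Set B}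
    (hS : ∀ l : GBAChar B, ∃ a ∈ S, l ∈ DS a) (t : B) :
    ∃ F : Finset B, (F : Set B) ⊆ S ∧ t ≤ F.sup id := by
  by_contra h
  obtain ⟨l, -, hl⟩ := exists_char_of_notMem_ideal (I := idealClosure S) (b := t) h
  obtain ⟨a, ha, hla⟩ := hS l
  have hla' : l.1 a = true := hla
  rw [hl a ⟨{a}, by simpa using ha, by simp⟩] at hla'
  exact Bool.false_ne_true hla'

lemma isOpen_DS {B : Type*} [GeneralizedBooleanAlgebra B] (a : B) : IsOpen (DS a) :=
  TopologicalSpace.isOpen_generateFrom_of_mem ⟨a, rfl⟩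

/-- The Stone space of a generalized Boolean algebra `B` is compact if and only if
`B` has a greatest element, i.e. `B` is a Boolean algebra. -/
theorem stone_space_compact_iff {B : Type*} [GeneralizedBooleanAlgebra B] :
    CompactSpace (GBAChar B) ↔ ∃ t : B, ∀ b : B, b ≤ t := by
  constructor
  · intro _
    obtain ⟨F, hF⟩ := isCompact_univ.elim_finite_subcover (DS : B → Set (GBAChar B)) isOpen_DS
      (fun l _ => Set.mem_iUnion.2 l.2.1)
    refine ⟨F.sup id, fun b => ?_⟩
    obtain ⟨G, hG, hb⟩ := exists_finset_le_sup_of_cover (S := F)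
      (fun l => by simpa using hF (Set.mem_univ l)) b
    exact hb.trans (Finset.sup_mono (by exact_mod_cast hG))
  · rintro ⟨t, ht⟩
    refine compactSpace_generateFrom rfl fun P hP hcov => ?_
    obtain ⟨F, hF, htF⟩ := exists_finset_le_sup_of_cover (S := {a | DS a ∈ P}) (fun l => by
      obtain ⟨s, hs, hls⟩ := Set.mem_sUnion.1 (hcov ▸ Set.mem_univ l)
      obtain ⟨a, rfl⟩ := hP hs
      exact ⟨a, hs, hls⟩) t
    refine ⟨DS '' (F : Set B), by rintro _ ⟨a, ha, rfl⟩; exact hF ha,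
      F.finite_toSet.image _, Set.eq_univ_of_forall fun l => ?_⟩
    obtain ⟨b, hb⟩ := l.2.1
    obtain ⟨a, ha, hla⟩ := (l.apply_finset_sup F).1 (l.mono ((ht b).trans htF) hb)
    exact ⟨DS a, ⟨a, ha, rfl⟩, hla⟩
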